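/- Let T = ⟨𝒜, 𝒲, d⟩ be a tag system with all words ω_i nonempty, ω a nonempty word over 𝒜, and P₀ a finite set of formulas in which the variable x⁰ does not occur. For every natural number n with n ≤ N_ω, every formula in ⟨P_{T,ω,P₀}⟩_n is either a substitution instance of a formula in Code_T(ω) or a substitution instance of an axiom of P_{T,P₀} (that is, ⟨P_{T,ω,P₀}⟩_n ⊆ Code_T(ω)* ∪ P_{T,P₀}*). -/

import Mathlib

/-- Propositional formulas over the signature {→}. -/
inductive Fm : Type
  | var : ℕ → Fm
  | imp : Fm → Fm → Fm
  deriving DecidableEq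

/-- Apply a substitution (uniform replacement of variables by formulas). -/
def Fm.subst (σ : ℕ → Fm) : Fm → Fm
  | var n => σ n
  | imp A B => imp (A.subst σ) (B.subst σ)

/-- Derivability from a set of axioms by modus ponens and substitution. -/
inductive Deriv (P : Set Fm) : Fm → Prop
  | ax {A : Fm} : A ∈ P → Deriv P A
  | mp {A B : Fm} : Deriv P A → Deriv P (A.imp B) → Deriv P B
  | subst (σ : ℕ → Fm) {A : Fm} : Deriv P A → Deriv P (A.subst σ)

/-- The fixed variable x⁰. -/
def x0 : Fm := Fm.var 0

/-- Axioms of the intuitionistic implicational calculus Int_{→}: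
A1: x → (y → x), A2: (x → (y → z)) → ((x → y) → (x → z)). -/
def IntAx : Set Fm :=
  { Fm.imp (Fm.var 0) (Fm.imp (Fm.var 1) (Fm.var 0)),
    Fm.imp (Fm.imp (Fm.var 0) (Fm.imp (Fm.var 1) (Fm.var 2)))
      (Fm.imp (Fm.imp (Fm.var 0) (Fm.var 1)) (Fm.imp (Fm.var 0) (Fm.var 2))) }

/-- A ∨ B abbreviates (A → B) → B. -/
def orF (A B : Fm) : Fm := (A.imp B).imp B

/-- E 0 = x⁰ → x⁰ (i.e. E_1), E (k+1) = E k → x⁰. -/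
def E : ℕ → Fm
  | 0 => x0.imp x0
  | n + 1 => (E n).imp x0

/-- The code of the letter a_i (letters are elements of `Fin m`). -/
def code {m : ℕ} (i : Fin m) : Fm := (E i.val).imp (x0.imp (x0.imp x0))

/-- The formula ▷ = ((x⁰ → x⁰) → x⁰) → x⁰. -/
def tri : Fm := ((x0.imp x0).imp x0).imp x0

/-- Right-nested disjunction of a nonempty list of formulas. -/
def rlist : List Fm → Fm
  | [] => x0
  | [A] => A
  | A :: B :: Bs => orF A (rlist (B :: Bs))

def llistAux : Fm → List Fm → Fm
  | A, [] => A
  | A, B :: Bs => llistAux (orF A B) Bs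

/-- Left-nested disjunction of a nonempty list of formulas. -/
def llist : List Fm → Fm
  | [] => x0
  | A :: As => llistAux A As

/-- \overrightarrow{α}: right-nested disjunction of codes of the letters of α. -/
def rword {m : ℕ} (w : List (Fin m)) : Fm := rlist (w.map code)

/-- \overleftarrow{α}: left-nested disjunction of codes of the letters of α. -/
def lword {m : ℕ} (w : List (Fin m)) : Fm := llist (w.map code)

/-- A substitution instance of a member of M. -/
def SubStar (M : Set Fm) : Set Fm := {F | ∃ A ∈ M, ∃ σ : ℕ → Fm, F = Fm.subst σ A}

/-- Two formulas are unifiable if they have a common substitution instance. -/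
def Unifiable (A B : Fm) : Prop := ∃ σ τ : ℕ → Fm, Fm.subst σ A = Fm.subst τ B

/-- The variable v occurs in a formula. -/
def Occurs (v : ℕ) : Fm → Prop
  | Fm.var w => v = w
  | Fm.imp A B => Occurs v A ∨ Occurs v B

/-- Alphabetic formulas (𝒜-formulas) over the alphabet `Fin m`. -/
inductive AForm (m : ℕ) : Fm → Prop
  | ofCode (i : Fin m) : AForm m (code i)
  | ofOr {A B : Fm} : AForm m A → AForm m B → AForm m (orF A B)

/-- A tag system ⟨𝒜, 𝒲, d⟩ with 𝒜 = Fin m. -/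
structure TagSystem where
  m : ℕ
  W : Fin m → List (Fin m)
  d : ℕ

/-- One production step of the tag system: a_i β γ ↦ γ ω_i, |β| = d - 1. -/
def TagStep (T : TagSystem) (ξ ζ : List (Fin T.m)) : Prop :=
  ∃ (i : Fin T.m) (β γ : List (Fin T.m)),
    β.length = T.d - 1 ∧ ξ = i :: (β ++ γ) ∧ ζ = γ ++ T.W i

/-- ⟹_T : reflexive–transitive closure of the one-step production. -/
def TagSteps (T : TagSystem) : List (Fin T.m) → List (Fin T.m) → Prop :=
  Relation.ReflTransGen (TagStep T)

/-- T halts on α: α produces some word shorter than d. -/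
def Halts (T : TagSystem) (α : List (Fin T.m)) : Prop :=
  ∃ β, TagSteps T α β ∧ β.length < T.d

/-- Axioms R1: (▷ → (y ∨ \overrightarrow{az}) ∨ u) → (▷ → (\overleftarrow{ya} ∨ z) ∨ u),
with y = var 1, z = var 2, u = var 3. -/
def R1Ax (m : ℕ) : Set Fm :=
  {F | ∃ a : Fin m, F =
    (tri.imp (orF (orF (Fm.var 1) (orF (code a) (Fm.var 2))) (Fm.var 3))).imp
      (tri.imp (orF (orF (orF (Fm.var 1) (code a)) (Fm.var 2)) (Fm.var 3)))}

/-- Axioms R2: (▷ → \overleftarrow{ya} ∨ z) → (▷ → y ∨ \overrightarrow{az}). -/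
def R2Ax (m : ℕ) : Set Fm :=
  {F | ∃ a : Fin m, F =
    (tri.imp (orF (orF (Fm.var 1) (code a)) (Fm.var 2))).imp
      (tri.imp (orF (Fm.var 1) (orF (code a) (Fm.var 2))))}

/-- Axioms T1: (▷ → \overrightarrow{a_i α y}) → (▷ → \overrightarrow{y ω_i}), |α| = d - 1. -/
def T1Ax (T : TagSystem) : Set Fm :=
  {F | ∃ (i : Fin T.m) (α : List (Fin T.m)), α.length = T.d - 1 ∧
    F = (tri.imp (rlist (((i :: α).map code) ++ [Fm.var 1]))).imp
      (tri.imp (rlist (Fm.var 1 :: (T.W i).map code)))}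

/-- Axioms T2: (▷ → \overrightarrow{a_i α}) → (▷ → \overrightarrow{ω_i}), |α| = d - 1. -/
def T2Ax (T : TagSystem) : Set Fm :=
  {F | ∃ (i : Fin T.m) (α : List (Fin T.m)), α.length = T.d - 1 ∧
    F = (tri.imp (rword (i :: α))).imp (tri.imp (rword (T.W i)))}

/-- P_T = T1 ∪ T2 ∪ R1 ∪ R2. -/
def PT (T : TagSystem) : Set Fm := T1Ax T ∪ T2Ax T ∪ R1Ax T.m ∪ R2Ax T.m

/-- Axioms H: (▷ → \overrightarrow{α}) → A for 0 < |α| < d and A ∈ P₀. -/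
def HAx (T : TagSystem) (P₀ : Finset Fm) : Set Fm :=
  {F | ∃ (α : List (Fin T.m)) (A : Fm), 0 < α.length ∧ α.length < T.d ∧ A ∈ P₀ ∧
    F = (tri.imp (rword α)).imp A}

/-- P_{T,P₀} = P_T ∪ H. -/
def PTP (T : TagSystem) (P₀ : Finset Fm) : Set Fm := PT T ∪ HAx T P₀

/-- The calculus P_{T,ω,P₀} = {W_ω} ∪ P_T ∪ H. -/
def PTot (T : TagSystem) (ω : List (Fin T.m)) (P₀ : Finset Fm) : Set Fm :=
  insert (tri.imp (rword ω)) (PTP T P₀)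

/-- Code(α): the four types of codes of a nonempty word α. -/
def CodeSet {m : ℕ} (α : List (Fin m)) : Set Fm :=
  {F | F = tri.imp (rword α)} ∪
  {F | ∃ α₁ α₂ : List (Fin m), α = α₁ ++ α₂ ∧ 2 ≤ α₁.length ∧ 1 ≤ α₂.length ∧
    F = tri.imp (orF (rword α₁) (rword α₂))} ∪
  {F | ∃ α₁ α₂ α₃ : List (Fin m), α = α₁ ++ α₂ ++ α₃ ∧
    2 ≤ α₁.length ∧ 2 ≤ α₂.length ∧ 1 ≤ α₃.length ∧
    F = tri.imp (orF (orF (lword α₁) (rword α₂)) (rword α₃))} ∪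
  {F | ∃ α₁ α₂ : List (Fin m), α = α₁ ++ α₂ ∧ 3 ≤ α₁.length ∧ 1 ≤ α₂.length ∧
    F = tri.imp (orF (lword α₁) (rword α₂))}

/-- Code_T(ω)*: substitution instances of codes of words produced from ω by T. -/
def CodeTStar (T : TagSystem) (ω : List (Fin T.m)) : Set Fm :=
  {F | ∃ β, TagSteps T ω β ∧ F ∈ SubStar (CodeSet β)}

/-- ⟨P⟩: one application of modus ponens or substitution to members of P. -/
def StepSet (P : Set Fm) : Set Fm :=
  {B | ∃ A, A ∈ P ∧ A.imp B ∈ P} ∪ {B | ∃ A ∈ P, ∃ σ : ℕ → Fm, B = Fm.subst σ A}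

/-- ⟨P⟩_n. -/
def Stages (P : Set Fm) : ℕ → Set Fm
  | 0 => P
  | n + 1 => StepSet (Stages P n)

/-! ### Helper lemmas -/

theorem subst_var (A : Fm) : A.subst Fm.var = A := by
  induction A with
  | var n => rfl
  | imp A B ihA ihB => simp [Fm.subst, ihA, ihB]

theorem subst_subst (σ τ : ℕ → Fm) (A : Fm) :
    (A.subst σ).subst τ = A.subst (fun n => (σ n).subst τ) := by
  induction A with
  | var n => rfl
  | imp A B ihA ihB => simp [Fm.subst, ihA, ihB]

def fsize : Fm → ℕ
  | Fm.var _ => 1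
  | Fm.imp A B => fsize A + fsize B + 1

def EX (X : Fm) : ℕ → Fm
  | 0 => X.imp X
  | n + 1 => (EX X n).imp X

def cX {m : ℕ} (X : Fm) (i : Fin m) : Fm := (EX X i.val).imp (X.imp (X.imp X))

def triX (X : Fm) : Fm := ((X.imp X).imp X).imp X

def rX {m : ℕ} (X : Fm) : List (Fin m) → Fm
  | [] => X
  | [a] => cX X a
  | a :: b :: l => orF (cX X a) (rX X (b :: l))

def lX {m : ℕ} (X : Fm) (w : List (Fin m)) : Fm := (lword w).subst (fun _ => X)

theorem E_subst (σ : ℕ → Fm) (n : ℕ) : (E n).subst σ = EX (σ 0) n := by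
  induction n with
  | zero => rfl
  | succ n ih => simp [E, EX, Fm.subst, ih, x0]

theorem code_subst {m : ℕ} (σ : ℕ → Fm) (i : Fin m) : (code i).subst σ = cX (σ 0) i := by
  simp [code, cX, Fm.subst, E_subst, x0]

theorem tri_subst (σ : ℕ → Fm) : tri.subst σ = triX (σ 0) := rfl

theorem orF_subst (σ : ℕ → Fm) (A B : Fm) :
    (orF A B).subst σ = orF (A.subst σ) (B.subst σ) := rfl

theorem rword_subst {m : ℕ} (σ : ℕ → Fm) (w : List (Fin m)) :
    (rword w).subst σ = rX (σ 0) w := by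
  induction w with
  | nil => rfl
  | cons a l ih =>
    cases l with
    | nil => exact code_subst σ a
    | cons b l =>
      have : rword (a :: b :: l) = orF (code a) (rword (b :: l)) := rfl
      rw [this, orF_subst, ih, code_subst]; rfl

theorem llistAux_subst {m : ℕ} (σ τ : ℕ → Fm) (h : σ 0 = τ 0) (w : List (Fin m)) :
    ∀ A : Fm, A.subst σ = A.subst τ →
    (llistAux A (w.map code)).subst σ = (llistAux A (w.map code)).subst τ := by
  induction w with
  | nil => intro A hA; exact hA
  | cons b l ih =>
    intro A hA
    simp only [List.map_cons, llistAux]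
    apply ih
    rw [orF_subst, orF_subst, hA, code_subst, code_subst, h]

theorem lword_subst {m : ℕ} (σ : ℕ → Fm) (w : List (Fin m)) :
    (lword w).subst σ = lX (σ 0) w := by
  cases w with
  | nil => rfl
  | cons a l =>
    exact llistAux_subst σ (fun _ => σ 0) rfl l (code a) (by rw [code_subst, code_subst])

theorem llistAux_append (l : List Fm) (B : Fm) : ∀ A : Fm,
    llistAux A (l ++ [B]) = orF (llistAux A l) B := by
  induction l with
  | nil => intro A; rfl
  | cons b l ih => intro A; exact ih _

theorem lX_snoc {m : ℕ} (X : Fm) (w : List (Fin m)) (hw : w ≠ []) (b : Fin m) :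
    lX X (w ++ [b]) = orF (lX X w) (cX X b) := by
  cases w with
  | nil => exact absurd rfl hw
  | cons a l =>
    have : lword (a :: l ++ [b]) = orF (lword (a :: l)) (code b) := by
      simp [lword, llist, llistAux_append]
    simp only [lX]
    rw [this, orF_subst, code_subst]

theorem lX_two {m : ℕ} (X : Fm) (a b : Fin m) : lX X [a, b] = orF (cX X a) (cX X b) := by
  change (orF (code a) (code b)).subst _ = _
  rw [orF_subst, code_subst, code_subst]

theorem orF_inj {A B C D : Fm} : orF A B = orF C D ↔ A = C ∧ B = D := by
  constructor
  · intro h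
    simp only [orF, Fm.imp.injEq] at h
    exact ⟨h.1.1, h.2⟩
  · rintro ⟨rfl, rfl⟩; rfl

theorem imp_ne_left (A B : Fm) : A.imp B ≠ A := by
  intro h
  have := congrArg fsize h
  simp only [fsize] at this
  omega

theorem imp_ne_right (A B : Fm) : A.imp B ≠ B := by
  intro h
  have := congrArg fsize h
  simp only [fsize] at this
  omega

theorem EX_size (X : Fm) (n : ℕ) : fsize (EX X n) = fsize X + (n + 1) * (fsize X + 1) := by
  induction n with
  | zero => simp [EX, fsize]; ring
  | succ n ih => simp [EX, fsize, ih]; ring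

theorem cX_inj {m : ℕ} {X : Fm} {i j : Fin m} (h : cX X i = cX X j) : i = j := by
  simp only [cX, Fm.imp.injEq, and_true] at h
  have h := congrArg fsize h
  rw [EX_size, EX_size] at h
  have h2 : (i.val + 1) * (fsize X + 1) = (j.val + 1) * (fsize X + 1) := by omega
  have h3 := Nat.eq_of_mul_eq_mul_right (by omega) h2
  exact Fin.ext (by omega)

theorem cX_ne_orF {m : ℕ} {X : Fm} {i : Fin m} {P Q : Fm} : cX X i ≠ orF P Q := by
  intro h
  simp only [cX, orF, Fm.imp.injEq] at h
  obtain ⟨h1, h2⟩ := h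
  have : X = Q := by
    cases hi : i.val with
    | zero => rw [hi] at h1; simp only [EX, Fm.imp.injEq] at h1; exact h1.2
    | succ k => rw [hi] at h1; simp only [EX, Fm.imp.injEq] at h1; exact h1.2
  rw [← this] at h2
  exact imp_ne_left _ _ h2

/-- `P` is a disjunction. -/
def IsOr (P : Fm) : Prop := ∃ U V, P = orF U V

theorem not_isOr_cX {m : ℕ} {X : Fm} {i : Fin m} : ¬ IsOr (cX X i) := by
  rintro ⟨U, V, h⟩; exact cX_ne_orF h

theorem isOr_rX {m : ℕ} {X : Fm} {w : List (Fin m)} (h : 2 ≤ w.length) : IsOr (rX X w) := by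
  match w, h with
  | a :: b :: l, _ => exact ⟨_, _, rfl⟩

theorem exists_snoc {m : ℕ} {w : List (Fin m)} {k : ℕ} (h : k + 1 ≤ w.length) :
    ∃ v b, w = v ++ [b] ∧ k ≤ v.length := by
  rcases List.eq_nil_or_concat w with rfl | ⟨v, b, rfl⟩
  · simp at h
  · exact ⟨v, b, by simp, by simpa using h⟩

theorem ne_nil_of_le {m : ℕ} {w : List (Fin m)} {k : ℕ} (h : k + 1 ≤ w.length) : w ≠ [] := by
  rintro rfl; simp at h

theorem isOr_lX {m : ℕ} {X : Fm} {w : List (Fin m)} (h : 2 ≤ w.length) : IsOr (lX X w) := by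
  obtain ⟨v, b, rfl, hv⟩ := exists_snoc h
  rw [lX_snoc X v (ne_nil_of_le hv)]
  exact ⟨_, _, rfl⟩

theorem rX_cons {m : ℕ} (X : Fm) (a : Fin m) (l : List (Fin m)) (h : l ≠ []) :
    rX X (a :: l) = orF (cX X a) (rX X l) := by
  cases l with
  | nil => exact absurd rfl h
  | cons b l => rfl

/-- Destruct a right-nested word equal to a disjunction. -/
theorem rX_eq_orF {m : ℕ} {X : Fm} {w : List (Fin m)} (hw : w ≠ []) {P Q : Fm}
    (h : rX X w = orF P Q) : ∃ a l, w = a :: l ∧ l ≠ [] ∧ P = cX X a ∧ Q = rX X l := by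
  match w, hw with
  | [a], _ => exact absurd h cX_ne_orF
  | a :: b :: l, _ =>
    obtain ⟨h1, h2⟩ := orF_inj.1 h
    exact ⟨a, b :: l, rfl, by simp, h1.symm, h2.symm⟩

theorem rX_inj {m : ℕ} {X : Fm} : ∀ {v w : List (Fin m)}, v ≠ [] → w ≠ [] →
    rX X v = rX X w → v = w := by
  intro v
  induction v with
  | nil => intro w h; exact absurd rfl h
  | cons a l ih =>
    intro w _ hw h
    by_cases hl : l = []
    · subst hl
      match w, hw with
      | [b], _ => rw [cX_inj (show cX X a = cX X b from h)]
      | b :: c :: l, _ => exact absurd h cX_ne_orF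
    · rw [rX_cons X a l hl] at h
      obtain ⟨b, l', rfl, hl', h1, h2⟩ := rX_eq_orF hw h.symm
      rw [cX_inj h1, ih hl hl' h2]

/-- The four shapes of codes of a word, with `X` in place of `x⁰`, without the prefix. -/
def Shape {m : ℕ} (X : Fm) (α : List (Fin m)) (F : Fm) : Prop :=
  F = rX X α ∨
  (∃ α₁ α₂ : List (Fin m), α = α₁ ++ α₂ ∧ 2 ≤ α₁.length ∧ 1 ≤ α₂.length ∧
    F = orF (rX X α₁) (rX X α₂)) ∨
  (∃ α₁ α₂ α₃ : List (Fin m), α = α₁ ++ α₂ ++ α₃ ∧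
    2 ≤ α₁.length ∧ 2 ≤ α₂.length ∧ 1 ≤ α₃.length ∧
    F = orF (orF (lX X α₁) (rX X α₂)) (rX X α₃)) ∨
  (∃ α₁ α₂ : List (Fin m), α = α₁ ++ α₂ ∧ 3 ≤ α₁.length ∧ 1 ≤ α₂.length ∧
    F = orF (lX X α₁) (rX X α₂))

theorem subStar_code {m : ℕ} (α : List (Fin m)) (F : Fm) :
    F ∈ SubStar (CodeSet α) ↔ ∃ X G, Shape X α G ∧ F = (triX X).imp G := by
  constructor
  · rintro ⟨A, hA, σ, rfl⟩
    rcases hA with ((rfl | ⟨a, b, h, h1, h2, rfl⟩) | ⟨a, b, c, h, h1, h2, h3, rfl⟩) |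
      ⟨a, b, h, h1, h2, rfl⟩
    · exact ⟨σ 0, _, Or.inl rfl, by simp [Fm.subst, tri_subst, rword_subst]⟩
    · exact ⟨σ 0, _, Or.inr (Or.inl ⟨a, b, h, h1, h2, rfl⟩),
        by simp [Fm.subst, tri_subst, rword_subst, orF_subst]⟩
    · exact ⟨σ 0, _, Or.inr (Or.inr (Or.inl ⟨a, b, c, h, h1, h2, h3, rfl⟩)),
        by simp [Fm.subst, tri_subst, rword_subst, lword_subst, orF_subst]⟩
    · exact ⟨σ 0, _, Or.inr (Or.inr (Or.inr ⟨a, b, h, h1, h2, rfl⟩)),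
        by simp [Fm.subst, tri_subst, rword_subst, lword_subst, orF_subst]⟩
  · rintro ⟨X, G, hG, rfl⟩
    rcases hG with rfl | ⟨a, b, h, h1, h2, rfl⟩ | ⟨a, b, c, h, h1, h2, h3, rfl⟩ |
      ⟨a, b, h, h1, h2, rfl⟩
    · exact ⟨_, Or.inl (Or.inl (Or.inl rfl)), fun _ => X,
        by simp [Fm.subst, tri_subst, rword_subst]⟩
    · exact ⟨_, Or.inl (Or.inl (Or.inr ⟨a, b, h, h1, h2, rfl⟩)), fun _ => X,
        by simp [Fm.subst, tri_subst, rword_subst, orF_subst]⟩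
    · exact ⟨_, Or.inl (Or.inr ⟨a, b, c, h, h1, h2, h3, rfl⟩), fun _ => X,
        by simp [Fm.subst, tri_subst, rword_subst, lword_subst, orF_subst]⟩
    · exact ⟨_, Or.inr ⟨a, b, h, h1, h2, rfl⟩, fun _ => X,
        by simp [Fm.subst, tri_subst, rword_subst, lword_subst, orF_subst]⟩

theorem triX_inj {X Y : Fm} (h : triX X = triX Y) : X = Y := by
  simp only [triX, Fm.imp.injEq] at h; exact h.2

/-- If the left disjunct is a letter, the shape is of type 0. -/
theorem Shape.type0 {m : ℕ} {X : Fm} {β : List (Fin m)} {a : Fin m} {Q : Fm}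
    (h : Shape X β (orF (cX X a) Q)) : orF (cX X a) Q = rX X β := by
  rcases h with h | ⟨_, _, _, h1, _, h⟩ | ⟨_, _, _, _, _, _, _, h⟩ | ⟨_, _, _, h1, _, h⟩
  · exact h
  · exact absurd (by rw [(orF_inj.1 h).1]; exact isOr_rX h1) (not_isOr_cX (X := X) (i := a))
  · exact absurd (orF_inj.1 h).1 cX_ne_orF
  · exact absurd (by rw [(orF_inj.1 h).1]; exact isOr_lX (by omega))
      (not_isOr_cX (X := X) (i := a))

theorem Shape.rX_inj {m : ℕ} {X : Fm} {β α : List (Fin m)} (hβ : β ≠ []) (hα : α ≠ [])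
    (h : Shape X β (rX X α)) : β = α := by
  match α, hα with
  | [a], _ =>
    rcases h with h | ⟨_, _, _, _, _, h⟩ | ⟨_, _, _, _, _, _, _, h⟩ | ⟨_, _, _, _, _, h⟩
    · exact (_root_.rX_inj (by simp) hβ h).symm
    all_goals exact absurd h cX_ne_orF
  | a :: b :: l, _ =>
    exact (_root_.rX_inj (v := a :: b :: l) (by simp) hβ (Shape.type0 h)).symm

theorem rX_split {m : ℕ} {X Y : Fm} {σ : ℕ → Fm} (h0 : σ 0 = X) (h1 : σ 1 = Y) :
    ∀ (α : List (Fin m)) (β : List (Fin m)), β ≠ [] →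
    rX X β = (rlist (α.map code ++ [Fm.var 1])).subst σ →
    ∃ γ, γ ≠ [] ∧ β = α ++ γ ∧ Y = rX X γ := by
  intro α
  induction α with
  | nil =>
    intro β hβ h
    exact ⟨β, hβ, rfl, by rw [h, ← h1]; rfl⟩
  | cons a l ih =>
    intro β hβ h
    have e : rlist ((a :: l).map code ++ [Fm.var 1]) =
        orF (code a) (rlist (l.map code ++ [Fm.var 1])) := by
      cases l <;> rfl
    rw [e, orF_subst, code_subst, h0] at h
    obtain ⟨b, l', rfl, hl', e1, e2⟩ := rX_eq_orF hβ h
    obtain ⟨γ, hγ, rfl, hY⟩ := ih l' hl' e2.symm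
    exact ⟨γ, hγ, by rw [cX_inj e1]; rfl, hY⟩

theorem shape_T1 {m : ℕ} {X : Fm} {γ w : List (Fin m)} (hγ : γ ≠ []) (hw : w ≠ []) :
    Shape X (γ ++ w) (orF (rX X γ) (rX X w)) := by
  match γ, hγ with
  | [a], _ => exact Or.inl (rX_cons X a w hw).symm
  | a :: b :: l, _ =>
    exact Or.inr (Or.inl ⟨_, w, rfl, by simp, List.length_pos_iff.2 hw, rfl⟩)

theorem shape_R2 {m : ℕ} {X Y Z : Fm} {a : Fin m} {β : List (Fin m)} (hβ : β ≠ [])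
    (h : Shape X β (orF (orF Y (cX X a)) Z)) : Shape X β (orF Y (orF (cX X a) Z)) := by
  rcases h with h | ⟨α₁, α₂, rfl, h1, h2, h⟩ | ⟨α₁, α₂, α₃, rfl, h1, h2, h3, h⟩ |
    ⟨α₁, α₂, rfl, h1, h2, h⟩
  · obtain ⟨_, _, _, _, e, _⟩ := rX_eq_orF hβ h.symm
    exact absurd e.symm cX_ne_orF
  · obtain ⟨e1, rfl⟩ := orF_inj.1 h
    obtain ⟨b, l, rfl, hl, rfl, e⟩ := rX_eq_orF (ne_nil_of_le h1) e1.symm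
    have : l = [a] := rX_inj hl (by simp) e.symm
    subst this
    left
    have h2' := ne_nil_of_le h2
    rw [← rX_cons X a α₂ h2', ← rX_cons X b _ (by simp)]; rfl
  · obtain ⟨e1, _⟩ := orF_inj.1 h
    obtain ⟨_, e2⟩ := orF_inj.1 e1
    exact absurd (by rw [e2]; exact isOr_rX h2) (not_isOr_cX (X := X) (i := a))
  · obtain ⟨e1, rfl⟩ := orF_inj.1 h
    obtain ⟨v, b, rfl, hv⟩ := exists_snoc h1
    rw [lX_snoc X v (ne_nil_of_le hv)] at e1
    obtain ⟨rfl, e2⟩ := orF_inj.1 e1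
    obtain rfl := cX_inj e2
    rw [← rX_cons X a α₂ (ne_nil_of_le h2)]
    by_cases h3 : 3 ≤ v.length
    · exact Or.inr (Or.inr (Or.inr ⟨v, a :: α₂, by simp, h3, by simp, rfl⟩))
    · match v, hv, h3 with
      | [p, q], _, _ =>
        exact Or.inr (Or.inl ⟨[p, q], a :: α₂, by simp, by simp, by simp, by
          rw [lX_two]; rfl⟩)
      | p :: q :: r :: s, _, h3 => exact absurd (by simp) h3

theorem shape_R1_aux {m : ℕ} {X : Fm} {v l w : List (Fin m)} (hv : 2 ≤ v.length) (hl : l ≠ [])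
    (hw : 1 ≤ w.length) : Shape X (v ++ l ++ w) (orF (orF (lX X v) (rX X l)) (rX X w)) := by
  match l, hl with
  | [c], _ =>
    refine Or.inr (Or.inr (Or.inr ⟨v ++ [c], w, rfl, by simp; omega, hw, ?_⟩))
    rw [lX_snoc X v (ne_nil_of_le hv)]; rfl
  | c :: c' :: l, _ =>
    exact Or.inr (Or.inr (Or.inl ⟨v, c :: c' :: l, w, rfl, hv, by simp, hw, rfl⟩))

theorem shape_R1 {m : ℕ} {X Y Z U : Fm} {a : Fin m} {β : List (Fin m)} (hβ : β ≠ [])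
    (h : Shape X β (orF (orF Y (orF (cX X a) Z)) U)) :
    Shape X β (orF (orF (orF Y (cX X a)) Z) U) := by
  rcases h with h | ⟨α₁, α₂, rfl, h1, h2, h⟩ | ⟨α₁, α₂, α₃, rfl, h1, h2, h3, h⟩ |
    ⟨α₁, α₂, rfl, h1, h2, h⟩
  · obtain ⟨_, _, _, _, e, _⟩ := rX_eq_orF hβ h.symm
    exact absurd e.symm cX_ne_orF
  · obtain ⟨e1, rfl⟩ := orF_inj.1 h
    obtain ⟨b, l, rfl, hl, rfl, e⟩ := rX_eq_orF (ne_nil_of_le h1) e1.symm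
    obtain ⟨c, l', rfl, hl', e2, rfl⟩ := rX_eq_orF hl e.symm
    obtain rfl := cX_inj e2
    rw [← lX_two]
    exact shape_R1_aux (v := [b, a]) (by simp) hl' h2
  · obtain ⟨e1, rfl⟩ := orF_inj.1 h
    obtain ⟨rfl, e⟩ := orF_inj.1 e1
    obtain ⟨c, l', rfl, hl', e2, rfl⟩ := rX_eq_orF (ne_nil_of_le h2) e.symm
    obtain rfl := cX_inj e2
    rw [← lX_snoc X α₁ (ne_nil_of_le h1)]
    have := shape_R1_aux (X := X) (v := α₁ ++ [a]) (l := l') (w := α₃) (by simp; omega) hl' h3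
    simpa using this
  · obtain ⟨e1, _⟩ := orF_inj.1 h
    obtain ⟨v, b, rfl, hv⟩ := exists_snoc h1
    rw [lX_snoc X v (ne_nil_of_le hv)] at e1
    exact absurd (orF_inj.1 e1).2.symm cX_ne_orF

theorem tagSteps_ne_nil {T : TagSystem} (hW : ∀ i, T.W i ≠ []) {ω β : List (Fin T.m)}
    (hω : ω ≠ []) (h : TagSteps T ω β) : β ≠ [] := by
  induction h with
  | refl => exact hω
  | tail _ h _ =>
    obtain ⟨i, _, γ, _, _, rfl⟩ := h
    simp [hW i]

/-- Every instance of an axiom of `P_{T,P₀}` has the form `(▷ → D) → F`. -/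
theorem subStar_PTP_form {T : TagSystem} {P₀ : Finset Fm} {A : Fm}
    (h : A ∈ SubStar (PTP T P₀)) : ∃ X D F, A = ((triX X).imp D).imp F := by
  obtain ⟨B, hB, σ, rfl⟩ := h
  rcases hB with (((⟨_, _, _, rfl⟩ | ⟨_, _, _, rfl⟩) | ⟨_, rfl⟩) | ⟨_, rfl⟩) |
    ⟨_, _, _, _, _, rfl⟩ <;> exact ⟨σ 0, _, _, rfl⟩

theorem triX_ne_triX_imp {X Y D : Fm} : triX X ≠ (triX Y).imp D := by
  intro h
  simp only [triX, Fm.imp.injEq] at h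
  obtain ⟨⟨h1, rfl⟩, _⟩ := h
  exact imp_ne_right _ _ h1.1.symm

theorem triX_ne_form {X Y D F : Fm} : triX X ≠ ((triX Y).imp D).imp F := by
  intro h
  simp only [triX, Fm.imp.injEq] at h
  obtain ⟨⟨⟨h1, h2⟩, _⟩, _⟩ := h
  rw [← h2] at h1
  exact imp_ne_right _ _ h1.symm

theorem mp_step (T : TagSystem) (hW : ∀ i, T.W i ≠ [])
    (ω : List (Fin T.m)) (hω : ω ≠ []) (P₀ : Finset Fm) (A B : Fm)
    (hA' : ∀ α : List (Fin T.m), α ≠ [] → α.length < T.d → A ∉ SubStar (CodeSet α))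
    (hd : 1 ≤ T.d)
    (hA : A ∈ CodeTStar T ω ∪ SubStar (PTP T P₀))
    (hAB : A.imp B ∈ CodeTStar T ω ∪ SubStar (PTP T P₀)) :
    B ∈ CodeTStar T ω := by
  rcases hAB with ⟨β, _, hβ⟩ | hAB
  · obtain ⟨X, G, _, e⟩ := (subStar_code _ _).1 hβ
    simp only [Fm.imp.injEq] at e
    obtain ⟨rfl, _⟩ := e
    rcases hA with ⟨γ, _, hγ⟩ | hA
    · obtain ⟨Y, G', _, e⟩ := (subStar_code _ _).1 hγ
      exact absurd e triX_ne_triX_imp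
    · obtain ⟨Y, D, F, e⟩ := subStar_PTP_form hA
      exact absurd e triX_ne_form
  · rcases hA with ⟨β, hωβ, hβ⟩ | hA
    · have hne := tagSteps_ne_nil hW hω hωβ
      obtain ⟨Y, G, hG, rfl⟩ := (subStar_code _ _).1 hβ
      obtain ⟨C, hC, σ, e⟩ := hAB
      rcases hC with (((⟨i, α, hα, rfl⟩ | ⟨i, α, hα, rfl⟩) | ⟨a, rfl⟩) | ⟨a, rfl⟩) |
        ⟨α, A, h1, h2, _, rfl⟩
      · simp only [Fm.subst, tri_subst, Fm.imp.injEq] at e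
        obtain ⟨⟨e1, rfl⟩, rfl⟩ := e
        obtain rfl := triX_inj e1
        have e : rlist ((i :: α).map code ++ [Fm.var 1]) =
            orF (code i) (rlist (α.map code ++ [Fm.var 1])) := by
          cases α <;> rfl
        have hG' := hG
        rw [e, orF_subst, code_subst] at hG'
        have h3 := hG'.type0
        rw [← code_subst, ← orF_subst, ← e] at h3
        obtain ⟨γ, hγ, rfl, hY⟩ := rX_split rfl rfl _ _ hne h3.symm
        refine ⟨γ ++ T.W i, hωβ.tail ⟨i, α, γ, hα, rfl, rfl⟩, (subStar_code _ _).2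
          ⟨σ 0, _, shape_T1 hγ (hW i), ?_⟩⟩
        have e : rlist (Fm.var 1 :: (T.W i).map code) = orF (Fm.var 1) (rword (T.W i)) := by
          have := hW i
          unfold rword
          cases hh : T.W i with
          | nil => exact absurd hh this
          | cons b l => rfl
        rw [e, orF_subst, rword_subst, ← hY]; rfl
      · simp only [Fm.subst, tri_subst, Fm.imp.injEq, rword_subst] at e
        obtain ⟨⟨e1, rfl⟩, rfl⟩ := e
        obtain rfl := triX_inj e1
        obtain rfl := hG.rX_inj hne (by simp)
        exact ⟨T.W i, hωβ.tail ⟨i, α, [], hα, by simp, rfl⟩, (subStar_code _ _).2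
          ⟨σ 0, _, Or.inl rfl, rfl⟩⟩
      · simp only [Fm.subst, tri_subst, Fm.imp.injEq, orF_subst, code_subst] at e
        obtain ⟨⟨e1, rfl⟩, rfl⟩ := e
        obtain rfl := triX_inj e1
        exact ⟨β, hωβ, (subStar_code _ _).2 ⟨σ 0, _, shape_R1 hne hG, rfl⟩⟩
      · simp only [Fm.subst, tri_subst, Fm.imp.injEq, orF_subst, code_subst] at e
        obtain ⟨⟨e1, rfl⟩, rfl⟩ := e
        obtain rfl := triX_inj e1
        exact ⟨β, hωβ, (subStar_code _ _).2 ⟨σ 0, _, shape_R2 hne hG, rfl⟩⟩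
      · exfalso
        simp only [Fm.subst, tri_subst, Fm.imp.injEq, rword_subst] at e
        obtain ⟨⟨e1, rfl⟩, _⟩ := e
        obtain rfl := triX_inj e1
        exact hA' α (List.length_pos_iff.1 h1) h2
          ((subStar_code _ _).2 ⟨σ 0, _, Or.inl rfl, rfl⟩)
    · obtain ⟨X, D, F, rfl⟩ := subStar_PTP_form hA
      obtain ⟨Y, D', F', e⟩ := subStar_PTP_form hAB
      simp only [Fm.imp.injEq] at e
      exact absurd e.1.1.symm triX_ne_triX_imp

theorem SubStar_subst {M : Set Fm} {A : Fm} (h : A ∈ SubStar M) (σ : ℕ → Fm) :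
    A.subst σ ∈ SubStar M := by
  obtain ⟨B, hB, τ, rfl⟩ := h
  exact ⟨B, hB, _, subst_subst τ σ B⟩

/-- For n ≤ N_ω, ⟨P_{T,ω,P₀}⟩_n ⊆ Code_T(ω)* ∪ P_{T,P₀}*. -/
theorem stmt_15 (T : TagSystem) (hW : ∀ i, T.W i ≠ []) (hd : 1 ≤ T.d)
    (ω : List (Fin T.m)) (hω : ω ≠ []) (P₀ : Finset Fm)
    (hx0 : ∀ A ∈ P₀, ¬ Occurs 0 A) (n : ℕ)
    (hn : ∀ k < n, ∀ α : List (Fin T.m), α ≠ [] → α.length < T.d →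
      SubStar (CodeSet α) ∩ Stages (PTot T ω P₀) k = ∅) :
    Stages (PTot T ω P₀) n ⊆ CodeTStar T ω ∪ SubStar (PTP T P₀) := by
  induction n with
  | zero =>
    rintro F (rfl | hF)
    · exact Or.inl ⟨ω, Relation.ReflTransGen.refl,
        _, Or.inl (Or.inl (Or.inl rfl)), Fm.var, (subst_var _).symm⟩
    · exact Or.inr ⟨F, hF, Fm.var, (subst_var _).symm⟩
  | succ n ih =>
    have ih := ih (fun k hk => hn k (by omega))
    rintro F (⟨A, hA, hAB⟩ | ⟨A, hA, σ, rfl⟩)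
    · refine Or.inl (mp_step T hW ω hω P₀ A F ?_ hd (ih hA) (ih hAB))
      intro α h1 h2 h3
      have := hn n (by omega) α h1 h2
      exact (Set.eq_empty_iff_forall_notMem.1 this) A ⟨h3, hA⟩
    · rcases ih hA with ⟨β, h1, h2⟩ | h
      · exact Or.inl ⟨β, h1, SubStar_subst h2 σ⟩
      · exact Or.inr (SubStar_subst h σ)
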